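/- Let X be a nonnegative random variable, l a positive integer, and C, c > 0, n ≥ 1 such that P(X < s) ≤ (C s / √l)^{l/2} + e^{-c n} for all s ≥ 0. Then for every t > 0, E[exp(-X²/t²)] ≤ (C' t / √l)^{l/2} Γ(l/4 + 1) + e^{-c n}, where C' depends only on C. -/

import Mathlib

open MeasureTheory

/-- If a nonnegative `X` satisfies the small-ball bound
`P(X < s) ≤ (Cs/√l)^{l/2} + e^{-cn}` for all `s ≥ 0`, then for all `t > 0`
`E[exp(-X²/t²)] ≤ (C't/√l)^{l/2} Γ(l/4+1) + e^{-cn}`, where `C'` depends only on `C`. -/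
theorem laplace_transform_from_small_ball (C : ℝ) (hC : 0 < C) :
    ∃ C' : ℝ, 0 < C' ∧
      ∀ (Ω : Type) (_ : MeasurableSpace Ω) (μ : Measure Ω), IsProbabilityMeasure μ →
        ∀ (X : Ω → ℝ), Measurable X → (∀ ω, 0 ≤ X ω) →
          ∀ (l : ℕ), 1 ≤ l → ∀ (c n : ℝ), 0 < c → 1 ≤ n →
            (∀ s : ℝ, 0 ≤ s →
              (μ {ω | X ω < s}).toReal ≤
                (C * s / Real.sqrt l) ^ ((l : ℝ) / 2) + Real.exp (-c * n)) →
            ∀ t : ℝ, 0 < t →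
              (∫ ω, Real.exp (-(X ω ^ 2) / t ^ 2) ∂μ) ≤
                (C' * t / Real.sqrt l) ^ ((l : ℝ) / 2) * Real.Gamma ((l : ℝ) / 4 + 1)
                  + Real.exp (-c * n) := by
  refine ⟨C, hC, ?_⟩
  intro Ω _ μ _ X hX hX0 l hl c n hc hn h t ht
  set Y : Ω → ℝ := fun ω => X ω ^ 2 / t ^ 2 with hY
  have hYm : Measurable Y := by fun_prop
  have hY0 : ∀ ω, 0 ≤ Y ω := fun ω => by positivity
  have hexp : IntegrableOn (fun v : ℝ => Real.exp (-v)) (Set.Ioi 0) := integrableOn_exp_neg_Ioi 0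
  set A : Set (Ω × ℝ) := {p | Y p.1 < p.2} with hA
  have hAm : MeasurableSet A :=
    measurableSet_lt (hYm.comp measurable_fst) measurable_snd
  set F : Ω → ℝ → ℝ := fun ω v => A.indicator (fun p => Real.exp (-p.2)) (ω, v) with hF
  have hFint : Integrable (Function.uncurry F) (μ.prod (volume.restrict (Set.Ioi (0 : ℝ)))) := by
    have h1 : Integrable (fun p : Ω × ℝ => Real.exp (-p.2))
        (μ.prod (volume.restrict (Set.Ioi (0 : ℝ)))) :=
      Integrable.comp_snd (f := fun v : ℝ => Real.exp (-v)) hexp μ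
    exact h1.indicator hAm
  have hswap := integral_integral_swap hFint
  have hleft : ∀ ω, ∫ v in Set.Ioi (0 : ℝ), F ω v = Real.exp (-(X ω ^ 2) / t ^ 2) := by
    intro ω
    have e1 : F ω = (Set.Ioi (Y ω)).indicator (fun v => Real.exp (-v)) := by
      funext v
      simp [hF, hA, Set.indicator_apply]
    rw [e1, setIntegral_indicator measurableSet_Ioi, Set.Ioi_inter_Ioi, sup_eq_right.2 (hY0 ω),
      integral_exp_neg_Ioi, neg_div]
  have hright : ∀ v, ∫ ω, F ω v ∂μ = μ.real {ω | Y ω < v} * Real.exp (-v) := by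
    intro v
    have e1 : (fun ω => F ω v) = {ω | Y ω < v}.indicator (fun _ => Real.exp (-v)) := by
      funext ω
      simp [hF, hA, Set.indicator_apply]
    rw [e1, integral_indicator_const _ (measurableSet_lt hYm measurable_const), smul_eq_mul]
  simp_rw [hleft, hright] at hswap
  rw [hswap]
  set a : ℝ := (l : ℝ) / 4 with ha
  have ha0 : 0 ≤ a := by positivity
  set K : ℝ := (C * t / Real.sqrt l) ^ ((l : ℝ) / 2) with hK
  have hG : IntegrableOn (fun v : ℝ => Real.exp (-v) * v ^ (a + 1 - 1)) (Set.Ioi 0) :=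
    Real.GammaIntegral_convergent (by linarith)
  have hR : IntegrableOn (fun v : ℝ => K * (Real.exp (-v) * v ^ (a + 1 - 1))
      + Real.exp (-c * n) * Real.exp (-v)) (Set.Ioi 0) :=
    (hG.const_mul K).add (hexp.const_mul _)
  have hval : ∫ v in Set.Ioi (0 : ℝ), (K * (Real.exp (-v) * v ^ (a + 1 - 1))
      + Real.exp (-c * n) * Real.exp (-v)) = K * Real.Gamma (a + 1) + Real.exp (-c * n) := by
    rw [integral_add (hG.const_mul K) (hexp.const_mul _), integral_const_mul, integral_const_mul,
      integral_exp_neg_Ioi, Real.Gamma_eq_integral (by linarith)]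
    simp
  rw [← hval]
  refine integral_mono_of_nonneg (Filter.Eventually.of_forall fun v => by positivity) hR ?_
  refine (ae_restrict_iff' measurableSet_Ioi).2 (Filter.Eventually.of_forall fun v hv => ?_)
  have hv : 0 < v := hv
  have hset : {ω | Y ω < v} = {ω | X ω < t * Real.sqrt v} := by
    ext ω
    have : t * Real.sqrt v = Real.sqrt (t ^ 2 * v) := by
      rw [Real.sqrt_mul (by positivity), Real.sqrt_sq ht.le]
    simp only [Set.mem_setOf_eq, hY]
    rw [this, Real.lt_sqrt (hX0 ω), div_lt_iff₀ (by positivity), mul_comm]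
  have hb := h (t * Real.sqrt v) (by positivity)
  rw [← hset] at hb
  have hpow : (C * (t * Real.sqrt v) / Real.sqrt l) ^ ((l : ℝ) / 2) = K * v ^ (a + 1 - 1) := by
    have e : C * (t * Real.sqrt v) / Real.sqrt l = (C * t / Real.sqrt l) * Real.sqrt v := by ring
    rw [e, Real.mul_rpow (by positivity) (by positivity), Real.sqrt_eq_rpow v,
      ← Real.rpow_mul hv.le]
    congr 2
    rw [ha]; ring
  rw [hpow] at hb
  have := mul_le_mul_of_nonneg_right hb (Real.exp_pos (-v)).le
  calc _ ≤ _ := this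
    _ = _ := by ring
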